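/- arXiv:1704.03893 — 2 statements merged into one kernel-verified Lean document; each statement's English description precedes it below -/
import Mathlib

section
/- Example 2, explicit bounded solution on the whole line: Define v : ℝ → ℝ by v(x) = 2e^{−1} for x ≤ −1; v(x) = −x + e^{−1}(2 − e^{−x}) for −1 ≤ x ≤ 0; v(x) = −x + e^{−1} e^{x} for 0 ≤ x ≤ 1; v(x) = 0 for x ≥ 1. Then: (a) the four expressions agree at x = −1, 0, 1, so v is well defined; (b) v is continuously differentiable on all of ℝ; (c) 0 ≤ v(x) ≤ 2e^{−1} for all x, so v is bounded; (d) for every x ∉ {−1, 0, 1}, v is twice differentiable at x and v″(x) + b(x) v′(x) = f(x), where b(x) = −sign(x) and f(x) = sign(x) for 0 < |x| < 1, f(x) = 0 otherwise; (e) v ≡ 2e^{−1} on (−∞, −1] and v ≡ 0 on [1, ∞), so v stabilizes to the constants 2e^{−1} and 0 as x → −∞ and x → +∞ respectively. -/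
open MeasureTheory Real

noncomputable section

namespace ConvDiff1D

/-- The drift `b(x) = -sign(x)` of Example 2. -/
def bfun : ℝ → ℝ := fun x => -Real.sign x

/-- The right-hand side of Example 2: `f(x) = sign(x)` for `0 < |x| < 1`, `f(x) = 0`
otherwise (note `Real.sign 0 = 0`). -/
def ffun : ℝ → ℝ := fun x => if |x| < 1 then Real.sign x else 0

/-- The explicit bounded solution `v` of `v'' + b v' = f` on the whole line from
Example 2. -/
def vsol : ℝ → ℝ := fun x =>
  if x ≤ -1 then 2 * Real.exp (-1)
  else if x ≤ 0 then -x + Real.exp (-1) * (2 - Real.exp (-x))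
  else if x ≤ 1 then -x + Real.exp (-1) * Real.exp x
  else 0

/-- Pasting two functions that agree at `c` and have the same derivative where they meet. -/
theorem hasDerivAt_ite_le {f g : ℝ → ℝ} {c d x : ℝ} (hf : x ≤ c → HasDerivAt f d x)
    (hg : c ≤ x → HasDerivAt g d x) (h : f c = g c) :
    HasDerivAt (fun y => if y ≤ c then f y else g y) d x := by
  rcases lt_trichotomy x c with hx | rfl | hx
  · refine (hf hx.le).congr_of_eventuallyEq ?_
    filter_upwards [Iio_mem_nhds hx] with y hy
    exact if_pos (le_of_lt hy)
  · rw [← hasDerivWithinAt_univ, ← Set.Iic_union_Ici (a := x)]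
    refine ((hf le_rfl).hasDerivWithinAt.congr_of_mem ?_ Set.self_mem_Iic).union
      ((hg le_rfl).hasDerivWithinAt.congr_of_mem ?_ Set.self_mem_Ici)
    · intro y hy
      exact if_pos hy
    · intro y hy
      rcases eq_or_lt_of_le (Set.mem_Ici.1 hy) with rfl | hy
      · simpa using h
      · exact if_neg hy.not_ge
  · refine (hg hx.le).congr_of_eventuallyEq ?_
    filter_upwards [Ioi_mem_nhds hx] with y hy
    exact if_neg (not_le.2 hy)

/-- The derivative of `vsol`. -/
def vsolDeriv : ℝ → ℝ := fun x => Real.exp (min |x| 1 - 1) - 1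

theorem vsolDeriv_of_one_le_abs {x : ℝ} (hx : 1 ≤ |x|) : vsolDeriv x = 0 := by
  simp [vsolDeriv, hx]

theorem vsolDeriv_of_mem_Icc_neg {x : ℝ} (h₁ : -1 ≤ x) (h₂ : x ≤ 0) :
    vsolDeriv x = Real.exp (-x - 1) - 1 := by
  rw [vsolDeriv, abs_of_nonpos h₂, min_eq_left (by linarith)]

theorem vsolDeriv_of_mem_Icc {x : ℝ} (h₁ : 0 ≤ x) (h₂ : x ≤ 1) :
    vsolDeriv x = Real.exp (x - 1) - 1 := by
  rw [vsolDeriv, abs_of_nonneg h₁, min_eq_left h₂]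

theorem exp_neg_one_mul_exp_one : Real.exp (-1) * Real.exp 1 = 1 := by
  rw [← Real.exp_add]
  simp

theorem hasDerivAt_vsol (x : ℝ) : HasDerivAt vsol (vsolDeriv x) x := by
  have e := exp_neg_one_mul_exp_one
  refine hasDerivAt_ite_le (fun hx => ?_) (fun hx₁ => hasDerivAt_ite_le (fun hx₂ => ?_)
    (fun hx₂ => hasDerivAt_ite_le (fun hx₃ => ?_) (fun hx₃ => ?_) ?_) ?_) ?_
  · rw [vsolDeriv_of_one_le_abs (le_abs.2 (Or.inr (by linarith)))]
    exact hasDerivAt_const x _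
  · rw [vsolDeriv_of_mem_Icc_neg hx₁ hx₂]
    refine ((hasDerivAt_neg x).add
      (((hasDerivAt_neg x).exp.const_sub 2).const_mul (Real.exp (-1)))).congr_deriv ?_
    rw [sub_eq_add_neg (-x), Real.exp_add]
    ring
  · rw [vsolDeriv_of_mem_Icc hx₂ hx₃]
    refine ((hasDerivAt_neg x).add
      ((Real.hasDerivAt_exp x).const_mul (Real.exp (-1)))).congr_deriv ?_
    rw [sub_eq_add_neg x, Real.exp_add]
    ring
  · rw [vsolDeriv_of_one_le_abs (le_abs.2 (Or.inl hx₃))]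
    exact hasDerivAt_const x _
  · linarith
  · norm_num
  · norm_num
    linarith

theorem deriv_vsol : deriv vsol = vsolDeriv :=
  funext fun x => (hasDerivAt_vsol x).deriv

theorem contDiff_vsol : ContDiff ℝ 1 vsol := by
  rw [contDiff_one_iff_deriv, deriv_vsol]
  refine ⟨fun x => (hasDerivAt_vsol x).differentiableAt, ?_⟩
  unfold vsolDeriv
  fun_prop

theorem antitone_vsol : Antitone vsol := by
  refine antitone_of_deriv_nonpos (fun x => (hasDerivAt_vsol x).differentiableAt) fun x => ?_
  rw [deriv_vsol]
  exact sub_nonpos.2 (Real.exp_le_one_iff.2 (sub_nonpos.2 (min_le_right _ _)))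

theorem vsol_of_le_neg_one {x : ℝ} (hx : x ≤ -1) : vsol x = 2 * Real.exp (-1) :=
  if_pos hx

theorem vsol_of_one_le {x : ℝ} (hx : 1 ≤ x) : vsol x = 0 := by
  rcases eq_or_lt_of_le hx with rfl | hx
  · have e := exp_neg_one_mul_exp_one
    norm_num [vsol]
    linarith
  · rw [vsol, if_neg (by linarith), if_neg (by linarith), if_neg (by linarith)]

theorem hasDerivAt_vsolDeriv_of_one_lt_abs {x : ℝ} (hx : 1 < |x|) :
    HasDerivAt vsolDeriv 0 x := by
  refine (hasDerivAt_const x (0 : ℝ)).congr_of_eventuallyEq ?_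
  filter_upwards [continuous_abs.continuousAt.eventually (Ioi_mem_nhds hx)] with y hy
  exact vsolDeriv_of_one_le_abs (le_of_lt hy)

theorem hasDerivAt_vsolDeriv_of_mem_Ioo_neg {x : ℝ} (h₁ : -1 < x) (h₂ : x < 0) :
    HasDerivAt vsolDeriv (-Real.exp (-x - 1)) x := by
  have h : HasDerivAt (fun y : ℝ => Real.exp (-y - 1) - 1) (-Real.exp (-x - 1)) x := by
    simpa using ((hasDerivAt_neg x).sub_const 1).exp.sub_const 1
  refine h.congr_of_eventuallyEq ?_
  filter_upwards [Ioo_mem_nhds h₁ h₂] with y hy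
  exact vsolDeriv_of_mem_Icc_neg hy.1.le hy.2.le

theorem hasDerivAt_vsolDeriv_of_mem_Ioo {x : ℝ} (h₁ : 0 < x) (h₂ : x < 1) :
    HasDerivAt vsolDeriv (Real.exp (x - 1)) x := by
  have h : HasDerivAt (fun y : ℝ => Real.exp (y - 1) - 1) (Real.exp (x - 1)) x := by
    simpa using ((hasDerivAt_id x).sub_const 1).exp.sub_const 1
  refine h.congr_of_eventuallyEq ?_
  filter_upwards [Ioo_mem_nhds h₁ h₂] with y hy
  exact vsolDeriv_of_mem_Icc hy.1.le hy.2.le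

theorem exists_deriv_vsolDeriv {x : ℝ} (h₁ : x ≠ -1) (h₂ : x ≠ 0) (h₃ : x ≠ 1) :
    ∃ v₂, HasDerivAt vsolDeriv v₂ x ∧ v₂ + bfun x * vsolDeriv x = ffun x := by
  rcases lt_or_ge 1 |x| with hx | hx
  · refine ⟨0, hasDerivAt_vsolDeriv_of_one_lt_abs hx, ?_⟩
    simp [vsolDeriv_of_one_le_abs hx.le, ffun, hx.not_gt]
  have h₄ : -1 < x := lt_of_le_of_ne (abs_le.1 hx).1 h₁.symm
  have h₅ : x < 1 := lt_of_le_of_ne (abs_le.1 hx).2 h₃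
  have h₆ : ffun x = Real.sign x := if_pos (abs_lt.2 ⟨h₄, h₅⟩)
  rcases lt_or_gt_of_ne h₂ with hx₀ | hx₀
  · refine ⟨_, hasDerivAt_vsolDeriv_of_mem_Ioo_neg h₄ hx₀, ?_⟩
    rw [h₆, bfun, vsolDeriv_of_mem_Icc_neg h₄.le hx₀.le, Real.sign_of_neg hx₀]
    ring
  · refine ⟨_, hasDerivAt_vsolDeriv_of_mem_Ioo hx₀ h₅, ?_⟩
    rw [h₆, bfun, vsolDeriv_of_mem_Icc hx₀.le h₅.le, Real.sign_of_pos hx₀]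
    ring

/-- **Example 2 (explicit bounded solution on the whole line).**
(a) The four defining expressions of `v` agree at `x = -1, 0, 1`;
(b) `v` is continuously differentiable on `ℝ`;
(c) `0 ≤ v ≤ 2e^{-1}`, so `v` is bounded;
(d) away from `{-1, 0, 1}`, `v` is twice differentiable and solves `v'' + b v' = f`;
(e) `v ≡ 2e^{-1}` on `(-∞, -1]` and `v ≡ 0` on `[1, ∞)`, so `v` stabilizes to the
constants `2e^{-1}` and `0` at `-∞` and `+∞` respectively. -/
theorem example2_bounded_solution :
    (2 * Real.exp (-1) = -(-1 : ℝ) + Real.exp (-1) * (2 - Real.exp (-(-1 : ℝ))) ∧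
      (-(0 : ℝ) + Real.exp (-1) * (2 - Real.exp (-(0 : ℝ)))
        = -(0 : ℝ) + Real.exp (-1) * Real.exp 0) ∧
      (-(1 : ℝ) + Real.exp (-1) * Real.exp 1 = 0)) ∧
    ContDiff ℝ 1 vsol ∧
    (∀ x : ℝ, 0 ≤ vsol x ∧ vsol x ≤ 2 * Real.exp (-1)) ∧
    (∀ x : ℝ, x ≠ -1 → x ≠ 0 → x ≠ 1 →
      ∃ v₁ v₂ : ℝ, HasDerivAt vsol v₁ x ∧ HasDerivAt (deriv vsol) v₂ x ∧
        v₂ + bfun x * v₁ = ffun x) ∧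
    ((∀ x : ℝ, x ≤ -1 → vsol x = 2 * Real.exp (-1)) ∧
      (∀ x : ℝ, 1 ≤ x → vsol x = 0)) := by
  have e := exp_neg_one_mul_exp_one
  refine ⟨⟨?_, ?_, ?_⟩, contDiff_vsol, fun x => ⟨?_, ?_⟩, fun x h₁ h₂ h₃ => ?_,
    fun x => vsol_of_le_neg_one, fun x => vsol_of_one_le⟩
  · rw [neg_neg]
    linarith
  · norm_num
  · linarith
  · rw [← vsol_of_one_le (le_max_right x 1)]
    exact antitone_vsol (le_max_left x 1)
  · rw [← vsol_of_le_neg_one (min_le_right x (-1))]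
    exact antitone_vsol (min_le_left x (-1))
  · obtain ⟨v₂, hv₂, h⟩ := exists_deriv_vsolDeriv h₁ h₂ h₃
    exact ⟨_, v₂, hasDerivAt_vsol x, deriv_vsol ▸ hv₂, h⟩

end ConvDiff1D
end
end

section
/- Example 1, exponential blow-up of Dirichlet approximations: Let k > 1, b(x) = −sign(x), and f the indicator function of [−1, 1]. If v : [−k, k] → ℝ is continuously differentiable with v(−k) = v(k) = 0, and v is twice differentiable at every x ∈ (−k, k) \ {−1, 0, 1} with v″(x) + b(x) v′(x) = f(x) at all such x, then necessarily v(0) = 1 − (e − 1) e^{k−1}. In particular |v(0)| → ∞ at exponential rate as k → ∞, so the solutions of the Dirichlet problems on the growing intervals (−k, k) can approximate no bounded function on ℝ. -/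
open MeasureTheory Real

noncomputable section

namespace ConvDiff1D

/-- The right-hand side of Example 1: the indicator function of `[-1, 1]`. -/
def find : ℝ → ℝ := Set.indicator (Set.Icc (-1 : ℝ) 1) (fun _ => (1 : ℝ))

/-- A function continuous on `[a, b]` with vanishing derivative inside takes equal end values. -/
theorem eq_of_hasDerivAt_zero {F : ℝ → ℝ} {a b : ℝ} (hab : a ≤ b)
    (hc : ContinuousOn F (Set.Icc a b)) (hd : ∀ x ∈ Set.Ioo a b, HasDerivAt F 0 x) :
    F b = F a := by
  rcases hab.eq_or_lt with rfl | hlt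
  · rfl
  · obtain ⟨c, _, h⟩ := exists_hasDerivAt_eq_slope F (fun _ => 0) hlt hc hd
    have hne : b - a ≠ 0 := (sub_pos.2 hlt).ne'
    field_simp at h
    linarith

/-- The value at `k` of a `C¹` solution of `v'' - v' = 1_{[0,1]}` on `[0, k]`, in terms of the
initial data `v 0` and `v' 0`. -/
theorem value_of_half_line_solution {k : ℝ} (hk : 1 < k) {v g : ℝ → ℝ}
    (hv : ContinuousOn v (Set.Icc 0 k)) (hg : ContinuousOn g (Set.Ico 0 k))
    (hvg : ∀ x ∈ Set.Ioo 0 k, HasDerivAt v (g x) x)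
    (hin : ∀ x ∈ Set.Ioo (0 : ℝ) 1, HasDerivAt g (g x + 1) x)
    (hout : ∀ x ∈ Set.Ioo 1 k, HasDerivAt g (g x) x) :
    v k = v 0 + (1 + g 0) * (exp 1 - 1) - 1
      + ((1 + g 0) * exp 1 - 1) * (exp (k - 1) - 1) := by
  have hexp_neg : ∀ x : ℝ, HasDerivAt (fun y => exp (-y)) (-exp (-x)) x := fun x => by
    simpa using (hasDerivAt_neg x).exp
  have hexp_sub : ∀ x : ℝ, HasDerivAt (fun y => exp (y - 1)) (exp (x - 1)) x := fun x => by
    simpa using ((hasDerivAt_id x).sub_const 1).exp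
  have g_in : ∀ t ∈ Set.Icc (0 : ℝ) 1, g t = (1 + g 0) * exp t - 1 := by
    intro t ht
    have h := eq_of_hasDerivAt_zero (F := fun x => (g x + 1) * exp (-x)) ht.1
      (((hg.mono fun x hx => ⟨hx.1, by linarith [hx.2, ht.2]⟩).add continuousOn_const).mul
        (by fun_prop))
      (fun x hx => by
        have := ((hin x ⟨hx.1, hx.2.trans_le ht.2⟩).add_const 1).mul (hexp_neg x)
        exact this.congr_deriv (by ring))
    simp only [neg_zero, exp_zero, mul_one] at h
    have h' : exp (-t) * exp t = 1 := by rw [← exp_add]; simp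
    linear_combination exp t * h - (g t + 1) * h'
  have g_out : ∀ t ∈ Set.Ico 1 k, g t = g 1 * exp (t - 1) := by
    intro t ht
    have h := eq_of_hasDerivAt_zero (F := fun x => g x * exp (-x)) ht.1
      ((hg.mono fun x hx => ⟨by linarith [hx.1], hx.2.trans_lt ht.2⟩).mul (by fun_prop))
      (fun x hx => by
        have := (hout x ⟨hx.1, hx.2.trans ht.2⟩).mul (hexp_neg x)
        exact this.congr_deriv (by ring))
    have h' : exp (-t) * exp t = 1 := by rw [← exp_add]; simp
    have h'' : exp (t - 1) = exp (-1) * exp t := by rw [← exp_add]; ring_nf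
    rw [h'']
    linear_combination exp t * h - g t * h'
  have v_in := eq_of_hasDerivAt_zero (F := fun x => v x - ((1 + g 0) * exp x - x)) zero_le_one
    ((hv.mono (Set.Icc_subset_Icc_right hk.le)).sub (by fun_prop))
    (fun x hx => by
      have := (hvg x ⟨hx.1, hx.2.trans hk⟩).sub
        (((hasDerivAt_exp x).const_mul (1 + g 0)).sub (hasDerivAt_id x))
      exact this.congr_deriv (by rw [g_in x ⟨hx.1.le, hx.2.le⟩]; ring))
  have v_out := eq_of_hasDerivAt_zero (F := fun x => v x - g 1 * exp (x - 1)) hk.le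
    ((hv.mono (Set.Icc_subset_Icc_left zero_le_one)).sub (by fun_prop))
    (fun x hx => by
      have := (hvg x ⟨zero_lt_one.trans hx.1, hx.2⟩).sub ((hexp_sub x).const_mul (g 1))
      exact this.congr_deriv (by rw [g_out x ⟨hx.1.le, hx.2⟩]; ring))
  simp only [sub_self, exp_zero, mul_one, g_in 1 ⟨zero_le_one, le_rfl⟩] at v_in v_out
  linear_combination v_in + v_out

/-- **Example 1 (exponential blow-up of Dirichlet approximations).** Let `k > 1`. If
`v` is continuously differentiable on `[-k, k]` with `v(±k) = 0` and satisfies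
`v'' + b v' = f` at every point of `(-k, k) \ {-1, 0, 1}` (where it is twice
differentiable), then `v(0) = 1 - (e - 1)e^{k-1}`; in particular `|v(0)| → ∞` at
exponential rate as `k → ∞`, so the Dirichlet approximations on growing intervals can
approximate no bounded function on `ℝ`. -/
theorem example1_blowup (k : ℝ) (hk : 1 < k) (v : ℝ → ℝ)
    (hv : ContDiffOn ℝ 1 v (Set.Icc (-k) k))
    (hvm : v (-k) = 0) (hvp : v k = 0)
    (hode : ∀ x ∈ Set.Ioo (-k) k, x ≠ -1 → x ≠ 0 → x ≠ 1 →
      ∃ v₂ : ℝ, HasDerivAt (deriv v) v₂ x ∧ v₂ + bfun x * deriv v x = find x) :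
    v 0 = 1 - (Real.exp 1 - 1) * Real.exp (k - 1) := by
  have hmem : ∀ {x}, x ∈ Set.Ioo (-k) k → Set.Icc (-k) k ∈ nhds x := fun hx =>
    Icc_mem_nhds hx.1 hx.2
  have hd : ∀ x ∈ Set.Ioo (-k) k, HasDerivAt v (deriv v x) x := fun x hx =>
    ((hv.contDiffAt (hmem hx)).differentiableAt one_ne_zero).hasDerivAt
  have hdc : ContinuousOn (deriv v) (Set.Ioo (-k) k) :=
    (hv.mono Set.Ioo_subset_Icc_self).continuousOn_deriv_of_isOpen isOpen_Ioo le_rfl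
  have hneg : Set.MapsTo (fun x : ℝ => -x) (Set.Icc 0 k) (Set.Icc (-k) k) := fun x hx =>
    ⟨by linarith [hx.2], by linarith [hx.1]⟩
  have hneg' : Set.MapsTo (fun x : ℝ => -x) (Set.Ico 0 k) (Set.Ioo (-k) k) := fun x hx =>
    ⟨by linarith [hx.2], by linarith [hx.1]⟩
  have hright := value_of_half_line_solution hk (v := v) (g := deriv v)
    (hv.continuousOn.mono (Set.Icc_subset_Icc_left (by linarith)))
    (hdc.mono fun x hx => ⟨by linarith [hx.1], hx.2⟩)
    (fun x hx => hd x ⟨by linarith [hx.1], hx.2⟩)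
    (fun x hx => by
      obtain ⟨h0, h1⟩ := hx
      obtain ⟨w, hw, he⟩ := hode x ⟨by linarith, by linarith⟩ (by linarith) h0.ne' h1.ne
      have hf : find x = 1 := Set.indicator_of_mem (by constructor <;> linarith) _
      rw [bfun, Real.sign_of_pos h0, hf] at he
      exact hw.congr_deriv (by linarith))
    (fun x hx => by
      obtain ⟨h1, h2⟩ := hx
      have h0 : 0 < x := by linarith
      obtain ⟨w, hw, he⟩ := hode x ⟨by linarith, h2⟩ (by linarith) h0.ne' h1.ne'
      have hf : find x = 0 := Set.indicator_of_notMem (fun h => by linarith [h.2]) _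
      rw [bfun, Real.sign_of_pos h0, hf] at he
      exact hw.congr_deriv (by linarith))
  have hleft := value_of_half_line_solution hk (v := fun x => v (-x)) (g := fun x => -deriv v (-x))
    (hv.continuousOn.comp (by fun_prop) hneg)
    (hdc.comp (by fun_prop) hneg').neg
    (fun x hx => by
      have := (hd (-x) (hneg' ⟨hx.1.le, hx.2⟩)).comp x (hasDerivAt_neg x)
      exact this.congr_deriv (by ring))
    (fun x hx => by
      obtain ⟨h0, h1⟩ := hx
      obtain ⟨w, hw, he⟩ := hode (-x) ⟨by linarith, by linarith⟩ (fun h => by linarith)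
        (fun h => by linarith) (fun h => by linarith)
      have hf : find (-x) = 1 := Set.indicator_of_mem (by constructor <;> linarith) _
      rw [bfun, Real.sign_of_neg (by linarith), hf] at he
      exact (hw.comp x (hasDerivAt_neg x)).neg.congr_deriv (by linarith))
    (fun x hx => by
      obtain ⟨h1, h2⟩ := hx
      obtain ⟨w, hw, he⟩ := hode (-x) ⟨by linarith, by linarith⟩ (fun h => by linarith)
        (fun h => by linarith) (fun h => by linarith)
      have hf : find (-x) = 0 := Set.indicator_of_notMem (fun h => by linarith [h.1]) _
      rw [bfun, Real.sign_of_neg (by linarith), hf] at he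
      exact (hw.comp x (hasDerivAt_neg x)).neg.congr_deriv (by linarith))
  simp only [neg_zero, hvm] at hleft
  rw [hvp] at hright
  linear_combination (-1 / 2 : ℝ) * (hright + hleft)

end ConvDiff1D
end
end
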